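/- arXiv:1507.05661 — 3 statements merged into one kernel-verified Lean document; each statement's English description precedes it below -/
import Mathlib

section
/- Let q ≥ 1 and let W₁ and W₂ be subspaces of so(q,ℝ) of the same finite dimension p ≥ 1. Suppose there exists a linear bijection φ : 𝔑_{W₁} → 𝔑_{W₂} that preserves the inner products (⟨φξ, φη⟩ = ⟨ξ, η⟩ for all ξ, η ∈ 𝔑_{W₁}) and is a Lie algebra isomorphism (φ([ξ, η]₁) = [φξ, φη]₂ for all ξ, η ∈ 𝔑_{W₁}). Then there exists g ∈ O(q,ℝ) with gW₁g⁻¹ = W₂. -/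
open Matrix

noncomputable section

/-- If the standard-form metric 2-step nilpotent Lie algebras
`𝔑_{W₁} = ℝ^q ⊕ W₁` and `𝔑_{W₂} = ℝ^q ⊕ W₂`, where `W₁, W₂` are `p`-dimensional (`p ≥ 1`)
subspaces of `so(q,ℝ)`, admit a linear bijection `φ` preserving the inner products and the
Lie brackets, then `W₁` and `W₂` are conjugate by an element `g` of `O(q,ℝ)`. Here the
bracket data `brᵢ` is characterized by `⟨[v,w], Y⟩₀ = (Yv)·w` for all `Y ∈ Wᵢ`, all elements
of `Wᵢ` are central, and the inner product is `⟨(v,Z),(w,Z')⟩ = v·w + trace (Z Z'ᵀ)`. -/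
theorem stmt1 (q p : ℕ) (hq : 1 ≤ q) (hp : 1 ≤ p)
    (W₁ W₂ : Submodule ℝ (Matrix (Fin q) (Fin q) ℝ))
    (hW₁ : ∀ Z ∈ W₁, Zᵀ = -Z) (hW₂ : ∀ Z ∈ W₂, Zᵀ = -Z)
    (hd₁ : Module.finrank ℝ W₁ = p) (hd₂ : Module.finrank ℝ W₂ = p)
    (br₁ : (Fin q → ℝ) → (Fin q → ℝ) → W₁)
    (hbr₁ : ∀ (v w : Fin q → ℝ) (Y : W₁),
      Matrix.trace ((br₁ v w : Matrix (Fin q) (Fin q) ℝ) * (Y : Matrix (Fin q) (Fin q) ℝ)ᵀ)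
        = (Y : Matrix (Fin q) (Fin q) ℝ).mulVec v ⬝ᵥ w)
    (br₂ : (Fin q → ℝ) → (Fin q → ℝ) → W₂)
    (hbr₂ : ∀ (v w : Fin q → ℝ) (Y : W₂),
      Matrix.trace ((br₂ v w : Matrix (Fin q) (Fin q) ℝ) * (Y : Matrix (Fin q) (Fin q) ℝ)ᵀ)
        = (Y : Matrix (Fin q) (Fin q) ℝ).mulVec v ⬝ᵥ w)
    (φ : ((Fin q → ℝ) × W₁) →ₗ[ℝ] ((Fin q → ℝ) × W₂))
    (hbij : Function.Bijective φ)
    (hinner : ∀ ξ η : (Fin q → ℝ) × W₁,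
      (φ ξ).1 ⬝ᵥ (φ η).1 +
        Matrix.trace (((φ ξ).2 : Matrix (Fin q) (Fin q) ℝ)
          * ((φ η).2 : Matrix (Fin q) (Fin q) ℝ)ᵀ)
        = ξ.1 ⬝ᵥ η.1 +
          Matrix.trace ((ξ.2 : Matrix (Fin q) (Fin q) ℝ)
            * (η.2 : Matrix (Fin q) (Fin q) ℝ)ᵀ))
    (hlie : ∀ ξ η : (Fin q → ℝ) × W₁,
      φ ((0 : Fin q → ℝ), br₁ ξ.1 η.1) = ((0 : Fin q → ℝ), br₂ (φ ξ).1 (φ η).1)) :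
    ∃ g : Matrix (Fin q) (Fin q) ℝ, g * gᵀ = 1 ∧
      (fun Z : Matrix (Fin q) (Fin q) ℝ => g * Z * g⁻¹) '' (W₁ : Set _) = (W₂ : Set _) := by
  have hzero : ∀ M N : Matrix (Fin q) (Fin q) ℝ,
      (∀ v w, M.mulVec v ⬝ᵥ w = N.mulVec v ⬝ᵥ w) → M = N := by
    intro M N h
    apply Matrix.ext
    intro i j
    have := h (Pi.single j 1) (Pi.single i 1)
    simpa using this
  -- the image of `ℝ^q` has no component in `W₂`
  have h2 : ∀ u : Fin q → ℝ, (φ (u, 0)).2 = 0 := by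
    intro u
    apply Subtype.ext
    apply hzero
    intro v w
    obtain ⟨ξ, hξ⟩ := hbij.2 (v, 0)
    obtain ⟨η, hη⟩ := hbij.2 (w, 0)
    have h := hinner (0, br₁ ξ.1 η.1) (u, 0)
    rw [hlie, hξ, hη] at h
    have h' := hbr₂ v w (φ (u, 0)).2
    simp at h
    rw [← h', h]
    simp
  let L : (Fin q → ℝ) →ₗ[ℝ] (Fin q → ℝ) :=
    (LinearMap.fst ℝ _ _).comp (φ.comp (LinearMap.inl ℝ _ _))
  let A : Matrix (Fin q) (Fin q) ℝ := LinearMap.toMatrix' L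
  have hA : ∀ u, φ (u, 0) = (A.mulVec u, 0) := by
    intro u
    refine Prod.ext ?_ (h2 u)
    change _ = (LinearMap.toMatrix' L).mulVec u
    rw [LinearMap.toMatrix'_mulVec]
    rfl
  have hAA : Aᵀ * A = 1 := by
    apply hzero
    intro v w
    have h := hinner (v, 0) (w, 0)
    rw [hA, hA] at h
    simp at h
    rw [one_mulVec, ← h, ← mulVec_mulVec, mulVec_transpose, ← dotProduct_mulVec]
  have hAA' : A * Aᵀ = 1 := mul_eq_one_comm.mp hAA
  have hinv : A⁻¹ = Aᵀ := Matrix.inv_eq_left_inv hAA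
  have h1 : ∀ Y : W₁, (φ (0, Y)).1 = 0 := by
    intro Y
    have h := hinner (0, Y) (Aᵀ.mulVec (φ (0, Y)).1, 0)
    rw [hA, mulVec_mulVec, hAA', one_mulVec] at h
    simp at h
    exact h
  have hT : ∀ Y : W₁, A * (Y : Matrix (Fin q) (Fin q) ℝ) * Aᵀ = (φ (0, Y)).2 := by
    intro Y
    have key : (Y : Matrix (Fin q) (Fin q) ℝ)
        = Aᵀ * ((φ (0, Y)).2 : Matrix (Fin q) (Fin q) ℝ) * A := by
      apply hzero
      intro v w
      have h := hinner (0, br₁ v w) (0, Y)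
      have hl := hlie (v, 0) (w, 0)
      simp only [hA] at hl
      rw [hl] at h
      simp only [zero_dotProduct, zero_add] at h
      rw [hbr₁, hbr₂] at h
      rw [← h, ← mulVec_mulVec, ← mulVec_mulVec, mulVec_transpose, ← dotProduct_mulVec]
    rw [key]
    calc A * (Aᵀ * ((φ (0, Y)).2 : Matrix (Fin q) (Fin q) ℝ) * A) * Aᵀ
        = (A * Aᵀ) * ((φ (0, Y)).2 : Matrix (Fin q) (Fin q) ℝ) * (A * Aᵀ) := by
          simp only [Matrix.mul_assoc]
      _ = _ := by rw [hAA', Matrix.one_mul, Matrix.mul_one]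
  refine ⟨A, hAA', ?_⟩
  rw [hinv]
  ext Z
  constructor
  · rintro ⟨Y, hY, rfl⟩
    have := hT ⟨Y, hY⟩
    simp only at this
    simp only [this]
    exact (φ (0, ⟨Y, hY⟩)).2.2
  · intro hZ
    obtain ⟨⟨u, Y⟩, hξ⟩ := hbij.2 (0, ⟨Z, hZ⟩)
    refine ⟨Y, Y.2, ?_⟩
    have hs : φ (u, Y) = φ (u, 0) + φ (0, Y) := by
      rw [← map_add]; simp
    rw [hs] at hξ
    have h := congrArg Prod.snd hξ
    rw [Prod.snd_add, h2, zero_add] at h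
    simp only [hT, h]
end
end

section
/- Let q ≥ 2 and let m ≥ 2 be an integer. Let O_m be the set of Z ∈ so(q,ℝ) such that the eigenvalues of Z are distinct (the characteristic polynomial of Z has q distinct roots in ℂ) and such that for any two distinct nonzero eigenvalues λ, μ of Z one has λ/μ ≠ m and λ/μ ≠ −m. Then O_m is a nonempty Zariski open subset of so(q,ℝ), and O_m is invariant under conjugation by elements of O(q,ℝ): gO_mg⁻¹ = O_m for every g ∈ O(q,ℝ). -/
open Matrix

noncomputable section

/-- The real vector space `so(q,ℝ)` of `q × q` real skew-symmetric matrices. -/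
def so (q : ℕ) : Submodule ℝ (Matrix (Fin q) (Fin q) ℝ) where
  carrier := {Z | Zᵀ = -Z}
  add_mem' := by
    intro a b ha hb
    simp only [Set.mem_setOf_eq] at *
    rw [Matrix.transpose_add, ha, hb, neg_add]
  zero_mem' := by
    simp only [Set.mem_setOf_eq, Matrix.transpose_zero, neg_zero]
  smul_mem' := by
    intro c a ha
    simp only [Set.mem_setOf_eq] at *
    rw [Matrix.transpose_smul, ha, smul_neg]

/-- The multiset of eigenvalues (in ℂ) of a real matrix: the roots of its characteristic
polynomial over ℂ. -/
def eigs {q : ℕ} (Z : Matrix (Fin q) (Fin q) ℝ) : Multiset ℂ :=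
  (Z.charpoly.map (algebraMap ℝ ℂ)).roots

/-- The algebra `K[V]` of polynomial functions on a `K`-vector space `V`: the `K`-subalgebra
of all functions `V → K` generated by the dual space `V*`. -/
def polyFuns (K V : Type*) [Field K] [AddCommGroup V] [Module K V] :
    Subalgebra K (V → K) :=
  Algebra.adjoin K {f : V → K | ∃ T : V →ₗ[K] K, f = ⇑T}

/-- A subset `A` of a `K`-vector space `V` is Zariski closed if it is the common zero set
of finitely many polynomial functions on `V`. -/
def IsZariskiClosed (K : Type*) {V : Type*} [Field K] [AddCommGroup V] [Module K V]
    (A : Set V) : Prop :=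
  ∃ (n : ℕ) (g : Fin n → (V → K)), (∀ i, g i ∈ polyFuns K V) ∧
    A = {v : V | ∀ i, g i v = 0}

/-- A subset of a `K`-vector space is Zariski open if its complement is Zariski closed. -/
def IsZariskiOpen (K : Type*) {V : Type*} [Field K] [AddCommGroup V] [Module K V]
    (A : Set V) : Prop :=
  IsZariskiClosed K Aᶜ


open Polynomial in
/-- The divided difference polynomial `(p(cX) - p(X)) / X`. -/
def sPoly {R : Type*} [CommRing R] (p : R[X]) (c : ℤ) : R[X] :=
  divX (p.comp (C (c : R) * X) - p)

open Polynomial in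
theorem sPoly_map {R S : Type*} [CommRing R] [CommRing S] (f : R →+* S) (p : R[X]) (c : ℤ) :
    (sPoly p c).map f = sPoly (p.map f) c := by
  unfold sPoly
  have : (p.map f).comp (C (c : S) * X) - p.map f = (p.comp (C (c : R) * X) - p).map f := by
    simp [Polynomial.map_comp]
  rw [this]
  ext n
  simp [coeff_divX, coeff_map]

open Polynomial in
theorem sPoly_eval {R : Type*} [CommRing R] (p : R[X]) (c : ℤ) (x : R) :
    x * (sPoly p c).eval x = p.eval (c * x) - p.eval x := by
  have h := X_mul_divX_add (p.comp (C (c : R) * X) - p)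
  have h2 := congrArg (eval x) h
  have h0 : (p.comp (C (c : R) * X) - p).coeff 0 = 0 := by
    rw [coeff_zero_eq_eval_zero]; simp [eval_comp]
  rw [h0] at h2
  simpa [eval_comp, sPoly] using h2

open Polynomial in
theorem sPoly_eval_zero {R : Type*} [CommRing R] (p : R[X]) (c : ℤ) :
    (sPoly p c).eval 0 = (c - 1) * p.derivative.eval 0 := by
  rw [← coeff_zero_eq_eval_zero, ← coeff_zero_eq_eval_zero, sPoly, coeff_divX, coeff_derivative,
    coeff_sub, comp_C_mul_X_coeff]
  simp; ring

open Polynomial in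
theorem aeval_matrix_map {q : ℕ} {R S : Type*} [CommRing R] [CommRing S] (f : R →+* S)
    (M : Matrix (Fin q) (Fin q) R) (p : R[X]) :
    f (aeval M p).det = (aeval (f.mapMatrix M) (p.map f)).det := by
  rw [RingHom.map_det]
  congr 1
  have hc : (algebraMap S (Matrix (Fin q) (Fin q) S)).comp f =
      f.mapMatrix.comp (algebraMap R (Matrix (Fin q) (Fin q) R)) := by
    ext a i j
    simp [Matrix.algebraMap_matrix_apply, apply_ite f]
  rw [aeval_def, aeval_def, hom_eval₂, eval₂_map, hc]

/-- The polynomial test function. -/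
def testF {q : ℕ} {R : Type*} [CommRing R] (M : Matrix (Fin q) (Fin q) R) (m : ℤ) : R :=
  (Polynomial.aeval M (Polynomial.derivative M.charpoly)).det *
  ((Polynomial.aeval M (sPoly M.charpoly m)).det *
  (Polynomial.aeval M (sPoly M.charpoly (-m))).det)

theorem testF_map {q : ℕ} {R S : Type*} [CommRing R] [CommRing S] (f : R →+* S)
    (M : Matrix (Fin q) (Fin q) R) (m : ℤ) : f (testF M m) = testF (f.mapMatrix M) m := by
  unfold testF
  rw [map_mul, map_mul, aeval_matrix_map, aeval_matrix_map, aeval_matrix_map, sPoly_map, sPoly_map,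
    ← Polynomial.derivative_map]
  simp only [RingHom.mapMatrix_apply, Matrix.charpoly_map]

open Polynomial in
theorem det_aeval_eq_zero {q : ℕ} (hq : 0 < q) (M : Matrix (Fin q) (Fin q) ℂ) (s : ℂ[X]) :
    (aeval M s).det = 0 ↔ ∃ z, M.charpoly.IsRoot z ∧ s.eval z = 0 := by
  have : Nonempty (Fin q) := ⟨⟨0, hq⟩⟩
  have hne : (spectrum ℂ M).Nonempty := by
    apply spectrum.nonempty_of_isAlgClosed_of_finiteDimensional
  have h := spectrum.map_polynomial_aeval_of_nonempty M s hne
  have h0 : (aeval M s).det = 0 ↔ (0 : ℂ) ∈ spectrum ℂ (aeval M s) := by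
    rw [spectrum.zero_mem_iff, Matrix.isUnit_iff_isUnit_det, isUnit_iff_ne_zero, not_not]
  rw [h0, h]
  simp only [Set.mem_image, Matrix.mem_spectrum_iff_isRoot_charpoly]

theorem mem_eigs {q : ℕ} (Z : Matrix (Fin q) (Fin q) ℝ) (z : ℂ) :
    z ∈ eigs Z ↔ ((algebraMap ℝ ℂ).mapMatrix Z).charpoly.IsRoot z := by
  unfold eigs
  rw [RingHom.mapMatrix_apply, Matrix.charpoly_map, Polynomial.mem_roots]
  exact ((Matrix.charpoly_monic Z).map _).ne_zero

theorem card_eigs {q : ℕ} (Z : Matrix (Fin q) (Fin q) ℝ) : (eigs Z).card = q := by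
  unfold eigs
  rw [IsAlgClosed.card_roots_eq_natDegree, Polynomial.natDegree_map, Matrix.charpoly_natDegree_eq_dim,
    Fintype.card_fin]

theorem distinct_iff {q : ℕ} (hq : 0 < q) (Z : Matrix (Fin q) (Fin q) ℝ) :
    (eigs Z).toFinset.card = q ↔ ∀ z ∈ eigs Z,
      (Polynomial.derivative ((algebraMap ℝ ℂ).mapMatrix Z).charpoly).eval z ≠ 0 := by
  have h1 : (eigs Z).toFinset.card = q ↔ (eigs Z).Nodup := by
    rw [← Multiset.toFinset_card_eq_card_iff_nodup, card_eigs]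
  have hne : ((algebraMap ℝ ℂ).mapMatrix Z).charpoly ≠ 0 := (Matrix.charpoly_monic _).ne_zero
  have h2 : eigs Z = ((algebraMap ℝ ℂ).mapMatrix Z).charpoly.roots := by
    unfold eigs; rw [RingHom.mapMatrix_apply, Matrix.charpoly_map]
  rw [h1, Multiset.nodup_iff_count_le_one, h2]
  constructor
  · intro h z hz h0
    have := h z
    rw [Polynomial.count_roots] at this
    have h3 := (Polynomial.one_lt_rootMultiplicity_iff_isRoot hne).2
      ⟨(Polynomial.mem_roots hne).1 hz, h0⟩
    omega
  · intro h z
    by_contra! hc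
    rw [Polynomial.count_roots] at hc
    have h3 := (Polynomial.one_lt_rootMultiplicity_iff_isRoot hne).1 hc
    exact h z ((Polynomial.mem_roots hne).2 h3.1) h3.2

theorem test_iff {q : ℕ} (hq : 2 ≤ q) (m : ℤ) (hm : 2 ≤ m) (Z : Matrix (Fin q) (Fin q) ℝ) :
    ((eigs Z).toFinset.card = q ∧
      ∀ lam mu : ℂ, lam ∈ eigs Z → mu ∈ eigs Z →
        lam ≠ mu → lam ≠ 0 → mu ≠ 0 → lam / mu ≠ (m : ℂ) ∧ lam / mu ≠ -(m : ℂ)) ↔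
    testF Z m ≠ 0 := by
  have hq' : 0 < q := by omega
  have e : testF Z m ≠ 0 ↔ testF ((algebraMap ℝ ℂ).mapMatrix Z) m ≠ 0 := by
    rw [← testF_map, Ne, Ne, map_eq_zero_iff _ (algebraMap ℝ ℂ).injective]
  rw [e, distinct_iff hq']
  unfold testF
  simp only [mem_eigs]
  set p := ((algebraMap ℝ ℂ).mapMatrix Z).charpoly with hp
  rw [mul_ne_zero_iff, mul_ne_zero_iff, Ne, Ne, Ne, det_aeval_eq_zero hq', det_aeval_eq_zero hq',
    det_aeval_eq_zero hq', ← hp]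
  push Not
  refine and_congr_right fun hd => ?_
  have key : ∀ c : ℤ, (c ≠ 0 ∧ c ≠ 1) → ((∀ z, p.IsRoot z → (sPoly p c).eval z ≠ 0) ↔
      ∀ lam mu : ℂ, p.IsRoot lam → p.IsRoot mu → lam ≠ mu → lam ≠ 0 → mu ≠ 0 →
        lam / mu ≠ (c : ℂ)) := by
    rintro c ⟨hc0, hc1⟩
    have hc0' : (c : ℂ) ≠ 0 := by exact_mod_cast hc0
    have hc1' : (c : ℂ) ≠ 1 := by exact_mod_cast hc1
    constructor
    · intro h lam mu hl hmu hne hl0 hmu0 hdiv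
      rw [div_eq_iff hmu0] at hdiv
      have := sPoly_eval p c mu
      rw [← hdiv, hl, hmu, sub_zero] at this
      exact h mu hmu ((mul_eq_zero.1 this).resolve_left hmu0)
    · intro h z hz hs
      by_cases hz0 : z = 0
      · subst hz0
        rw [sPoly_eval_zero] at hs
        exact hd 0 hz ((mul_eq_zero.1 hs).resolve_left (sub_ne_zero.2 hc1'))
      · have := sPoly_eval p c z
        rw [hs, hz, sub_zero, mul_zero] at this
        refine h (c * z) z this.symm hz ?_ (mul_ne_zero hc0' hz0) hz0 (by field_simp)
        intro h'
        exact hc1' (mul_right_cancel₀ hz0 (by rw [h', one_mul]))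
  rw [key m (by omega), key (-m) (by omega)]
  push_cast
  constructor
  · intro h
    exact ⟨fun a b h1 h2 h3 h4 h5 => (h a b h1 h2 h3 h4 h5).1,
      fun a b h1 h2 h3 h4 h5 => (h a b h1 h2 h3 h4 h5).2⟩
  · intro h a b h1 h2 h3 h4 h5
    exact ⟨h.1 a b h1 h2 h3 h4 h5, h.2 a b h1 h2 h3 h4 h5⟩

theorem testF_poly (q : ℕ) (m : ℤ) :
    (fun Z : so q => testF (Z : Matrix (Fin q) (Fin q) ℝ) m) ∈ polyFuns ℝ (so q) := by
  let E : Matrix (Fin q) (Fin q) (polyFuns ℝ (so q)) := Matrix.of fun i j =>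
    ⟨fun Z => (Z : Matrix (Fin q) (Fin q) ℝ) i j, Algebra.subset_adjoin
      ⟨(Matrix.entryLinearMap ℝ ℝ i j).comp (so q).subtype, rfl⟩⟩
  have : (fun Z : so q => testF (Z : Matrix (Fin q) (Fin q) ℝ) m) =
      ((testF E m : polyFuns ℝ (so q)) : so q → ℝ) := by
    funext Z
    have h := testF_map ((Pi.evalRingHom (fun _ : so q => ℝ) Z).comp
      (polyFuns ℝ (so q)).val.toRingHom) E m
    exact h.symm
  rw [this]
  exact (testF E m).2

/-- Real parameters for the example. -/
def theta (q : ℕ) (i : Fin q) : ℤ :=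
  if 2 * (i : ℤ) < q - 1 then 2 * i - (q - 1) - 2 * q
  else if 2 * (i : ℤ) = q - 1 then 0 else 2 * i - (q - 1) + 2 * q

theorem theta_rev (q : ℕ) (i : Fin q) : theta q i.rev = - theta q i := by
  unfold theta
  have h := i.2
  have : ((i.rev : ℕ) : ℤ) = q - 1 - i := by rw [Fin.val_rev]; omega
  rw [this]
  split_ifs <;> omega

theorem theta_inj (q : ℕ) : Function.Injective (theta q) := by
  intro i j h
  unfold theta at h
  ext
  split_ifs at h <;> omega

theorem theta_bound (q : ℕ) (i : Fin q) (h : theta q i ≠ 0) :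
    2 * q < |theta q i| ∧ |theta q i| < 4 * q := by
  unfold theta at *
  have := i.2
  split_ifs at * <;> first | omega | (constructor <;> rw [lt_abs] <;> omega) |
    (constructor; (rw [lt_abs]; omega); (rw [abs_lt]; omega))

/-- The example matrix. -/
def exZ (q : ℕ) : Matrix (Fin q) (Fin q) ℝ :=
  Matrix.of fun i j => if j = i.rev then (theta q i : ℝ) else 0

theorem exZ_mem (q : ℕ) : exZ q ∈ so q := by
  change (exZ q)ᵀ = - exZ q
  ext i j
  simp only [exZ, Matrix.transpose_apply, Matrix.of_apply, Matrix.neg_apply]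
  by_cases h : j = i.rev
  · subst h; simp [theta_rev]
  · have : ¬ i = j.rev := by rintro rfl; simp at h
    simp [h, this]

theorem exZ_eig (q : ℕ) (i : Fin q) : Complex.I * (theta q i : ℂ) ∈ eigs (exZ q) := by
  rw [mem_eigs, ← Matrix.mem_spectrum_iff_isRoot_charpoly, spectrum.mem_iff,
    Matrix.isUnit_iff_isUnit_det, isUnit_iff_ne_zero, not_not, ← Matrix.exists_mulVec_eq_zero_iff]
  refine ⟨Pi.single i 1 + Pi.single i.rev Complex.I, ?_, ?_⟩
  · intro h
    have h1 := congrFun h i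
    by_cases hi : i = i.rev
    · rw [← hi] at h1
      have := congrArg Complex.re h1
      simp at this
    · simp [Pi.single_apply, hi] at h1
  · ext j
    have hm : ∀ v : Fin q → ℂ, ((algebraMap ℝ ℂ).mapMatrix (exZ q) *ᵥ v) j
        = theta q j * v j.rev := by
      intro v
      simp [Matrix.mulVec, dotProduct, exZ, apply_ite]
    rw [Matrix.sub_mulVec, Pi.sub_apply, hm, Algebra.algebraMap_eq_smul_one, Matrix.smul_mulVec,
      Matrix.one_mulVec]
    simp only [Pi.smul_apply, Pi.add_apply, smul_eq_mul, Pi.single_apply, Pi.zero_apply,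
      Fin.rev_inj, Fin.rev_eq_iff]
    by_cases h1 : j = i
    · subst h1
      by_cases h2 : j = j.rev
      · have : theta q j = 0 := by have := theta_rev q j; rw [← h2] at this; omega
        simp [this]
      · simp [h2, mul_comm]
    · by_cases h2 : j = i.rev
      · subst h2
        simp only [h1, theta_rev]
        simp [h1]
        linear_combination (theta q i : ℂ) * Complex.I_mul_I
      · simp [h1, h2]

theorem exZ_eigs (q : ℕ) : (eigs (exZ q)).toFinset.card = q ∧
    ∀ z ∈ eigs (exZ q), ∃ i, z = Complex.I * (theta q i : ℂ) := by
  classical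
  have hinj : Function.Injective (fun i : Fin q => Complex.I * (theta q i : ℂ)) := by
    intro i j h
    have := mul_left_cancel₀ Complex.I_ne_zero h
    exact theta_inj q (by exact_mod_cast this)
  set S := Finset.univ.image (fun i : Fin q => Complex.I * (theta q i : ℂ)) with hS
  have hcard : S.card = q := by rw [hS, Finset.card_image_of_injective _ hinj]; simp
  have hsub : S ⊆ (eigs (exZ q)).toFinset := by
    intro z hz
    rw [hS, Finset.mem_image] at hz
    obtain ⟨i, -, rfl⟩ := hz
    exact Multiset.mem_toFinset.2 (exZ_eig q i)
  have hle : (eigs (exZ q)).toFinset.card ≤ q := by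
    have := Multiset.toFinset_card_le (eigs (exZ q))
    rwa [card_eigs] at this
  have heq := Finset.eq_of_subset_of_card_le hsub (by rw [hcard]; exact hle)
  refine ⟨by rw [← heq, hcard], fun z hz => ?_⟩
  rw [← Multiset.mem_toFinset, ← heq, hS, Finset.mem_image] at hz
  obtain ⟨i, -, h⟩ := hz
  exact ⟨i, h.symm⟩

theorem exZ_ratio (q : ℕ) (m : ℤ) (hm : 2 ≤ |m|) (i j : Fin q)
    (hi : Complex.I * (theta q i : ℂ) ≠ 0) (hj : Complex.I * (theta q j : ℂ) ≠ 0) :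
    Complex.I * (theta q i : ℂ) / (Complex.I * (theta q j : ℂ)) ≠ (m : ℂ) := by
  intro h
  rw [div_eq_iff hj] at h
  have h2 : (theta q i : ℂ) = m * theta q j :=
    mul_left_cancel₀ Complex.I_ne_zero (by rw [h]; ring)
  have h3 : theta q i = m * theta q j := by exact_mod_cast h2
  have hi' : theta q i ≠ 0 := by rintro h; simp [h] at hi
  have hj' : theta q j ≠ 0 := by rintro h; simp [h] at hj
  have b1 := theta_bound q i hi'
  have b2 := theta_bound q j hj'
  rw [h3, abs_mul] at b1
  nlinarith

theorem eigs_conj {q : ℕ} (g : Matrix (Fin q) (Fin q) ℝ) (hg : g * gᵀ = 1)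
    (Z : Matrix (Fin q) (Fin q) ℝ) : eigs (g * Z * gᵀ) = eigs Z := by
  have := Matrix.charpoly_units_conj ⟨g, gᵀ, hg, mul_eq_one_comm.1 hg⟩ Z
  unfold eigs
  have hinv : g⁻¹ = gᵀ := Matrix.inv_eq_right_inv hg
  simp only [hinv] at this
  exact congrArg (fun p => (Polynomial.map (algebraMap ℝ ℂ) p).roots) this

theorem conj_mem {q : ℕ} (g : Matrix (Fin q) (Fin q) ℝ)
    (Z : Matrix (Fin q) (Fin q) ℝ) (hZ : Z ∈ so q) : g * Z * gᵀ ∈ so q := by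
  change (g * Z * gᵀ)ᵀ = -(g * Z * gᵀ)
  have hZ' : Zᵀ = -Z := hZ
  simp [Matrix.transpose_mul, hZ', Matrix.mul_assoc]

/-- for `q ≥ 2` and an integer `m ≥ 2`, the set `O_m` of `Z ∈ so(q,ℝ)` with
distinct eigenvalues such that no ratio of two distinct nonzero eigenvalues equals `m` or
`−m` is a nonempty Zariski open subset of `so(q,ℝ)` which is invariant under conjugation
by elements of `O(q,ℝ)`. -/
theorem stmt2 (q : ℕ) (hq : 2 ≤ q) (m : ℤ) (hm : 2 ≤ m)
    (Om : Set (so q))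
    (hOm : Om = {Z : so q | (eigs (Z : Matrix (Fin q) (Fin q) ℝ)).toFinset.card = q ∧
      ∀ lam mu : ℂ, lam ∈ eigs (Z : Matrix (Fin q) (Fin q) ℝ) →
        mu ∈ eigs (Z : Matrix (Fin q) (Fin q) ℝ) →
        lam ≠ mu → lam ≠ 0 → mu ≠ 0 → lam / mu ≠ (m : ℂ) ∧ lam / mu ≠ -(m : ℂ)}) :
    Om.Nonempty ∧ IsZariskiOpen ℝ Om ∧
    ∀ g : Matrix (Fin q) (Fin q) ℝ, g * gᵀ = 1 →
      (fun Z : so q => g * (Z : Matrix (Fin q) (Fin q) ℝ) * g⁻¹) '' Om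
        = ((↑) : so q → Matrix (Fin q) (Fin q) ℝ) '' Om := by
  have hmem : ∀ Z : so q, Z ∈ Om ↔ testF (Z : Matrix (Fin q) (Fin q) ℝ) m ≠ 0 := by
    intro Z
    rw [hOm, ← test_iff hq m hm]
    rfl
  refine ⟨⟨⟨exZ q, exZ_mem q⟩, ?_⟩, ?_, ?_⟩
  · rw [hOm]
    refine ⟨(exZ_eigs q).1, ?_⟩
    intro lam mu hl hmu _ hl0 hmu0
    obtain ⟨i, rfl⟩ := (exZ_eigs q).2 lam hl
    obtain ⟨j, rfl⟩ := (exZ_eigs q).2 mu hmu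
    refine ⟨exZ_ratio q m (by rw [le_abs]; omega) i j hl0 hmu0, ?_⟩
    have := exZ_ratio q (-m) (by rw [le_abs]; omega) i j hl0 hmu0
    push_cast at this
    exact this
  · refine ⟨1, fun _ Z => testF (Z : Matrix (Fin q) (Fin q) ℝ) m, fun _ => testF_poly q m, ?_⟩
    ext Z
    rw [Set.mem_compl_iff, hmem]
    simp
  · have main : ∀ g : Matrix (Fin q) (Fin q) ℝ, g * gᵀ = 1 → ∀ Z : so q, Z ∈ Om →
        (⟨g * (Z : Matrix (Fin q) (Fin q) ℝ) * gᵀ, conj_mem g _ Z.2⟩ : so q) ∈ Om := by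
      intro g hg Z hZ
      rw [hOm] at hZ ⊢
      simp only [Set.mem_setOf_eq, eigs_conj g hg] at hZ ⊢
      exact hZ
    intro g hg
    have hg' : gᵀ * g = 1 := mul_eq_one_comm.1 hg
    have hinv : g⁻¹ = gᵀ := Matrix.inv_eq_right_inv hg
    rw [hinv]
    ext W
    constructor
    · rintro ⟨Z, hZ, rfl⟩
      exact ⟨_, main g hg Z hZ, rfl⟩
    · rintro ⟨Z, hZ, rfl⟩
      refine ⟨_, main gᵀ (by rw [Matrix.transpose_transpose]; exact hg') Z hZ, ?_⟩
      change g * (gᵀ * (Z : Matrix (Fin q) (Fin q) ℝ) * gᵀᵀ) * gᵀ = Z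
      rw [Matrix.transpose_transpose]
      calc _ = (g * gᵀ) * (Z : Matrix (Fin q) (Fin q) ℝ) * (g * gᵀ) := by
            simp only [Matrix.mul_assoc]
        _ = _ := by rw [hg]; simp
end
end

section
/- Let q ≥ 2 and let O be the set of Z ∈ so(q,ℝ) such that the eigenvalues of Z are distinct (the characteristic polynomial of Z has q distinct roots in ℂ) and such that for any two distinct nonzero eigenvalues λ, μ of Z the ratio λ/μ is not an integer of absolute value ≥ 2. Then: (a) O is open in the norm topology of so(q,ℝ); (b) O is invariant under conjugation by elements of O(q,ℝ): gOg⁻¹ = O for every g ∈ O(q,ℝ); and (c) the complement so(q,ℝ) ∖ O has measure zero with respect to the Haar (Lebesgue) measure on the finite-dimensional real vector space so(q,ℝ). -/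
open Matrix MeasureTheory

noncomputable section

/-- The (Borel) measurable structure on matrices, given entrywise. -/
instance matrixMeasurableSpace {m n α : Type*} [MeasurableSpace α] :
    MeasurableSpace (Matrix m n α) :=
  (inferInstance : MeasurableSpace (m → n → α))

open Polynomial in
/-- The reduced characteristic polynomial: divide by `X` when `q` is odd. -/
def cpR {R : Type*} [CommRing R] {q : ℕ} (M : Matrix (Fin q) (Fin q) R) : Polynomial R :=
  if Odd q then M.charpoly.divX else M.charpoly

/-- complexification -/
def cx {q : ℕ} (Z : Matrix (Fin q) (Fin q) ℝ) : Matrix (Fin q) (Fin q) ℂ :=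
  Z.map (algebraMap ℝ ℂ)

theorem eigs_eq {q : ℕ} (Z : Matrix (Fin q) (Fin q) ℝ) : eigs Z = (cx Z).charpoly.roots := by
  unfold eigs cx
  rw [Matrix.charpoly_map]

theorem mem_eigs_s3 {q : ℕ} (Z : Matrix (Fin q) (Fin q) ℝ) (x : ℂ) :
    x ∈ eigs Z ↔ (cx Z).charpoly.eval x = 0 := by
  rw [eigs_eq, Polynomial.mem_roots (Matrix.charpoly_monic _).ne_zero, Polynomial.IsRoot]

theorem card_eigs_iff {q : ℕ} (Z : Matrix (Fin q) (Fin q) ℝ) :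
    (eigs Z).toFinset.card = q ↔
      ∀ x : ℂ, (cx Z).charpoly.eval x = 0 → (cx Z).charpoly.derivative.eval x ≠ 0 := by
  have h0 : (cx Z).charpoly ≠ 0 := (Matrix.charpoly_monic _).ne_zero
  have hc : Multiset.card (eigs Z) = q := by
    rw [eigs_eq, IsAlgClosed.card_roots_eq_natDegree, Matrix.charpoly_natDegree_eq_dim]
    simp
  have h1 : (eigs Z).toFinset.card = q ↔ (eigs Z).Nodup := by
    rw [← Multiset.toFinset_card_eq_card_iff_nodup, hc]
  rw [h1, Multiset.nodup_iff_count_le_one]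
  constructor
  · intro h x hx hx'
    have := h x
    rw [eigs_eq, Polynomial.count_roots] at this
    have h2 := (Polynomial.one_lt_rootMultiplicity_iff_isRoot h0 (t := x)).2 ⟨hx, hx'⟩
    omega
  · intro h x
    by_contra hcon
    rw [eigs_eq, Polynomial.count_roots] at hcon
    have h2 := (Polynomial.one_lt_rootMultiplicity_iff_isRoot h0 (t := x)).1 (by omega)
    exact h x h2.1 h2.2

theorem charpoly_skew {q : ℕ} {M : Matrix (Fin q) (Fin q) ℂ} (h : Mᵀ = -M) (k : ℕ) :
    M.charpoly.coeff k = (-1) ^ q * (-1) ^ k * M.charpoly.coeff k := by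
  have key : M.charpoly = (Polynomial.C ((-1 : ℂ) ^ q)) * M.charpoly.comp (-Polynomial.X) := by
    apply Polynomial.funext
    intro x
    rw [Polynomial.eval_mul, Polynomial.eval_C, Polynomial.eval_comp, Polynomial.eval_neg,
      Polynomial.eval_X, Matrix.eval_charpoly, Matrix.eval_charpoly, ← Matrix.det_transpose]
    have : (Matrix.scalar (Fin q) x - M)ᵀ = -(Matrix.scalar (Fin q) (-x) - M) := by
      rw [Matrix.transpose_sub, h]
      ext i j
      by_cases hij : i = j
      · subst hij
        simp [Matrix.scalar_apply]
        ring
      · simp [Matrix.scalar_apply, hij]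
    rw [this, Matrix.det_neg]
    simp
  conv_lhs => rw [key]
  have h3 : -(Polynomial.X : Polynomial ℂ) = Polynomial.C (-1) * Polynomial.X := by simp
  rw [Polynomial.coeff_C_mul, h3, Polynomial.comp_C_mul_X_coeff]
  ring

theorem cx_skew {q : ℕ} (Z : so q) : (cx (Z : Matrix (Fin q) (Fin q) ℝ))ᵀ = -cx (Z : Matrix (Fin q) (Fin q) ℝ) := by
  have h : (Z : Matrix (Fin q) (Fin q) ℝ)ᵀ = -Z := Z.2
  unfold cx
  rw [← Matrix.transpose_map, h]
  ext i j
  simp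

theorem cpR_R1 {q : ℕ} {M : Matrix (Fin q) (Fin q) ℂ} (h : Mᵀ = -M) {x : ℂ} (hx : x ≠ 0) :
    M.charpoly.eval x = 0 ↔ (cpR M).eval x = 0 := by
  unfold cpR
  split_ifs with hq
  · have h0 : M.charpoly.coeff 0 = 0 := by
      have := charpoly_skew h 0
      rw [hq.neg_one_pow] at this
      have h2 : 2 * M.charpoly.coeff 0 = 0 := by linear_combination this
      simpa using h2
    have := Polynomial.divX_mul_X_add M.charpoly
    rw [h0, map_zero, add_zero] at this
    conv_lhs => rw [← this]
    simp [hx]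
  · rfl

theorem cpR_R2 {q : ℕ} {M : Matrix (Fin q) (Fin q) ℂ} (h : Mᵀ = -M) 
    (h0 : (cpR M).eval 0 = 0) : M.charpoly.eval 0 = 0 ∧ M.charpoly.derivative.eval 0 = 0 := by
  rw [← Polynomial.coeff_zero_eq_eval_zero] at h0
  rw [← Polynomial.coeff_zero_eq_eval_zero, ← Polynomial.coeff_zero_eq_eval_zero, 
    Polynomial.coeff_derivative]
  unfold cpR at h0
  split_ifs at h0 with hq
  · have h1 : M.charpoly.coeff 0 = 0 := by
      have := charpoly_skew h 0
      rw [hq.neg_one_pow] at this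
      have h2 : 2 * M.charpoly.coeff 0 = 0 := by linear_combination this
      simpa using h2
    rw [Polynomial.coeff_divX] at h0
    simp [h0, h1]
  · have h1 : M.charpoly.coeff 1 = 0 := by
      have := charpoly_skew h 1
      rw [(Nat.not_odd_iff_even.1 hq).neg_one_pow] at this
      have h2 : 2 * M.charpoly.coeff 1 = 0 := by linear_combination this
      simpa using h2
    simp [h0, h1]

/-- goodness -/
def Good {q : ℕ} (M : Matrix (Fin q) (Fin q) ℂ) : Prop :=
  (∀ x : ℂ, M.charpoly.eval x = 0 → M.charpoly.derivative.eval x ≠ 0) ∧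
  ∀ m : ℤ, 2 ≤ |m| → ∀ x : ℂ, M.charpoly.eval x = 0 → (cpR M).eval ((m : ℂ) * x) ≠ 0

theorem good_iff {q : ℕ} (Z : so q) :
    ((eigs (Z : Matrix (Fin q) (Fin q) ℝ)).toFinset.card = q ∧
      ∀ lam mu : ℂ, lam ∈ eigs (Z : Matrix (Fin q) (Fin q) ℝ) →
        mu ∈ eigs (Z : Matrix (Fin q) (Fin q) ℝ) →
        lam ≠ mu → lam ≠ 0 → mu ≠ 0 →
        ∀ m : ℤ, 2 ≤ |m| → lam / mu ≠ (m : ℂ)) ↔ Good (cx (Z : Matrix (Fin q) (Fin q) ℝ)) := by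
  have hs := cx_skew Z
  rw [card_eigs_iff]
  unfold Good
  refine and_congr_right fun hd => ?_
  constructor
  · intro h m hm x hx hr
    have hm0 : (m : ℂ) ≠ 0 := by
      intro h0
      have : m = 0 := by exact_mod_cast h0
      simp [this] at hm
    by_cases hx0 : x = 0
    · subst hx0
      rw [mul_zero] at hr
      obtain ⟨h1, h2⟩ := cpR_R2 hs hr
      exact hd 0 h1 h2
    · rw [← cpR_R1 hs (mul_ne_zero hm0 hx0)] at hr
      refine h (m * x) x ((mem_eigs_s3 _ _).2 hr) ((mem_eigs_s3 _ _).2 hx) ?_ (mul_ne_zero hm0 hx0) hx0 m hm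
        (by field_simp)
      intro he
      have : (m : ℂ) = 1 := by
        apply mul_right_cancel₀ hx0; rw [he, one_mul]
      have : m = 1 := by exact_mod_cast this
      simp [this] at hm
  · intro h lam mu hl hmu _ hl0 hmu0 m hm he
    rw [mem_eigs_s3] at hl hmu
    have : lam = m * mu := by rw [← he]; field_simp
    apply h m hm mu hmu
    rw [← this, ← cpR_R1 hs hl0]
    exact hl

section openness
open Filter Topology

theorem exists_bound (q : ℕ) : ∃ B : Matrix (Fin q) (Fin q) ℂ → ℝ, Continuous B ∧
    ∀ M x, M.charpoly.eval x = 0 → ‖x‖ ≤ B M := by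
  let _ : NormedRing (Matrix (Fin q) (Fin q) ℂ) := Matrix.linftyOpNormedRing
  let _ : NormedAlgebra ℂ (Matrix (Fin q) (Fin q) ℂ) := Matrix.linftyOpNormedAlgebra
  have : CompleteSpace (Matrix (Fin q) (Fin q) ℂ) := FiniteDimensional.complete ℂ _
  refine ⟨fun M => ‖M‖ * ‖(1 : Matrix (Fin q) (Fin q) ℂ)‖, ?_, ?_⟩
  · exact (continuous_norm).mul continuous_const
  · intro M x hx
    have : x ∈ spectrum ℂ M := Matrix.mem_spectrum_iff_isRoot_charpoly.2 hx
    exact spectrum.norm_le_norm_mul_of_mem this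

theorem continuous_coeff_charpoly (q k : ℕ) :
    Continuous fun M : Matrix (Fin q) (Fin q) ℂ => M.charpoly.coeff k := by
  have h : ∀ M : Matrix (Fin q) (Fin q) ℂ, M.charpoly.coeff k =
      MvPolynomial.eval (fun ij : Fin q × Fin q => M ij.1 ij.2) 
        ((Matrix.charpoly.univ ℂ (Fin q)).coeff k) := by
    intro M
    have := Matrix.charpoly.univ_coeff_eval₂Hom (Fin q) (RingHom.id ℂ) (fun ij : Fin q × Fin q => M ij.1 ij.2) k
    exact this.symm
  simp_rw [h]
  refine (MvPolynomial.continuous_eval _).comp ?_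
  exact continuous_pi fun ij => Continuous.matrix_elem continuous_id _ _

theorem continuous_poly {T : Type*} [TopologicalSpace T] (P : T → Polynomial ℂ) (N : ℕ)
    (hN : ∀ t, (P t).natDegree < N) (hP : ∀ k, Continuous fun t => (P t).coeff k) :
    Continuous fun a : T × ℂ => (P a.1).eval a.2 := by
  have : (fun a : T × ℂ => (P a.1).eval a.2) = 
      fun a : T × ℂ => ∑ i ∈ Finset.range N, (P a.1).coeff i * a.2 ^ i := by
    funext a
    exact Polynomial.eval_eq_sum_range' (hN _) _
  rw [this]
  refine continuous_finsetSum _ fun i _ => ?_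
  exact ((hP i).comp continuous_fst).mul (continuous_snd.pow i)

theorem cont_charpoly (q : ℕ) :
    Continuous fun a : Matrix (Fin q) (Fin q) ℂ × ℂ => a.1.charpoly.eval a.2 :=
  continuous_poly _ (q + 1) (fun M => by simp [Matrix.charpoly_natDegree_eq_dim])
    (continuous_coeff_charpoly q)

theorem cont_deriv (q : ℕ) :
    Continuous fun a : Matrix (Fin q) (Fin q) ℂ × ℂ => a.1.charpoly.derivative.eval a.2 := by
  refine continuous_poly (fun M : Matrix (Fin q) (Fin q) ℂ => M.charpoly.derivative) (q + 1) 
    (fun M => ?_) fun k => ?_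
  · have := Polynomial.natDegree_derivative_le M.charpoly
    rw [Matrix.charpoly_natDegree_eq_dim, Fintype.card_fin] at this
    omega
  · simp_rw [Polynomial.coeff_derivative]
    exact (continuous_coeff_charpoly q _).mul continuous_const

theorem cont_cpR (q : ℕ) :
    Continuous fun a : Matrix (Fin q) (Fin q) ℂ × ℂ => (cpR a.1).eval a.2 := by
  by_cases hq : Odd q
  · simp only [cpR, if_pos hq]
    refine continuous_poly (fun M : Matrix (Fin q) (Fin q) ℂ => M.charpoly.divX) (q + 1) 
      (fun M => ?_) fun k => ?_
    · rw [Polynomial.natDegree_divX_eq_natDegree_tsub_one, Matrix.charpoly_natDegree_eq_dim,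
        Fintype.card_fin]
      omega
    · simp_rw [Polynomial.coeff_divX]
      exact continuous_coeff_charpoly q _
  · simp only [cpR, if_neg hq]
    exact cont_charpoly q

theorem subseq {q : ℕ} {M : ℕ → Matrix (Fin q) (Fin q) ℂ} {L : Matrix (Fin q) (Fin q) ℂ}
    (hM : Tendsto M atTop (𝓝 L)) {x : ℕ → ℂ} (hx : ∀ n, (M n).charpoly.eval (x n) = 0) :
    ∃ y : ℂ, ∃ φ : ℕ → ℕ, StrictMono φ ∧ Tendsto (x ∘ φ) atTop (𝓝 y) ∧ L.charpoly.eval y = 0 := by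
  obtain ⟨B, hB, hB'⟩ := exists_bound q
  have h1 : Tendsto (fun n => B (M n)) atTop (𝓝 (B L)) := (hB.tendsto _).comp hM
  obtain ⟨C, hC⟩ := h1.bddAbove_range
  have h2 : ∀ n, x n ∈ Metric.closedBall (0 : ℂ) C := by
    intro n
    rw [mem_closedBall_zero_iff]
    exact (hB' _ _ (hx n)).trans (hC ⟨n, rfl⟩)
  obtain ⟨y, _, φ, hφ, hy⟩ := tendsto_subseq_of_bounded Metric.isBounded_closedBall h2
  refine ⟨y, φ, hφ, hy, ?_⟩
  have h3 : Tendsto (fun n => ((M (φ n)), (x (φ n)))) atTop (𝓝 (L, y)) :=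
    (hM.comp hφ.tendsto_atTop).prodMk_nhds hy
  have h4 := ((cont_charpoly q).tendsto (L, y)).comp h3
  refine tendsto_nhds_unique h4 ?_
  simp [Function.comp_def, hx]

theorem bad_closed {q : ℕ} {M : ℕ → Matrix (Fin q) (Fin q) ℂ} {L : Matrix (Fin q) (Fin q) ℂ}
    (hs : ∀ n, (M n)ᵀ = -(M n)) (hsL : Lᵀ = -L)
    (hM : Tendsto M atTop (𝓝 L)) (hbad : ∀ n, ¬ Good (M n)) : ¬ Good L := by
  intro hL
  have hcase : ∀ n, (∃ x, (M n).charpoly.eval x = 0 ∧ (M n).charpoly.derivative.eval x = 0) ∨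
      (∃ m : ℤ, 2 ≤ |m| ∧ ∃ x, x ≠ 0 ∧ (M n).charpoly.eval x = 0 ∧
        (cpR (M n)).eval x = 0 ∧ (M n).charpoly.eval (m * x) = 0 ∧ 
        (cpR (M n)).eval (m * x) = 0) := by
    intro n
    by_contra hcon
    push Not at hcon
    obtain ⟨h1, h2⟩ := hcon
    refine hbad n ⟨h1, ?_⟩
    intro m hm x hx hr
    by_cases hx0 : x = 0
    · subst hx0
      rw [mul_zero] at hr
      obtain ⟨h3, h4⟩ := cpR_R2 (hs n) hr
      exact h1 0 h3 h4
    · have hm0 : (m : ℂ) ≠ 0 := by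
        intro h0
        have : m = 0 := by exact_mod_cast h0
        simp [this] at hm
      exact h2 m hm x hx0 hx ((cpR_R1 (hs n) hx0).1 hx)
        ((cpR_R1 (hs n) (mul_ne_zero hm0 hx0)).2 hr) hr
  by_cases hf : ∃ᶠ n in atTop, 
      (∃ x, (M n).charpoly.eval x = 0 ∧ (M n).charpoly.derivative.eval x = 0)
  · obtain ⟨ψ, hψ, hx⟩ := extraction_of_frequently_atTop hf
    choose x hx1 hx2 using hx
    have hM' : Tendsto (fun n => M (ψ n)) atTop (𝓝 L) := hM.comp hψ.tendsto_atTop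
    obtain ⟨y, φ, hφ, hy, hy0⟩ := subseq hM' hx1
    refine hL.1 y hy0 ?_
    have h3 : Tendsto (fun n => ((M (ψ (φ n))), (x (φ n)))) atTop (𝓝 (L, y)) :=
      (hM'.comp hφ.tendsto_atTop).prodMk_nhds hy
    have h4 := ((cont_deriv q).tendsto (L, y)).comp h3
    refine tendsto_nhds_unique h4 ?_
    simp [Function.comp_def, hx2]
  · rw [not_frequently] at hf
    have hf2 := (hf.mono fun n hn => (hcase n).resolve_left hn).frequently
    obtain ⟨ψ, hψ, hx⟩ := extraction_of_frequently_atTop hf2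
    choose m hm x hx0 hx1 hx2 hx3 hx4 using hx
    have hM' : Tendsto (fun n => M (ψ n)) atTop (𝓝 L) := hM.comp hψ.tendsto_atTop
    obtain ⟨y, φ, hφ, hy, hy0⟩ := subseq hM' hx1
    have hM'' : Tendsto (fun n => M (ψ (φ n))) atTop (𝓝 L) := hM'.comp hφ.tendsto_atTop
    obtain ⟨z, θ, hθ, hz, hz0⟩ := subseq hM'' (fun n => hx3 (φ n))
    have hM3 : Tendsto (fun n => M (ψ (φ (θ n)))) atTop (𝓝 L) := hM''.comp hθ.tendsto_atTop
    have hy3 : Tendsto (fun n => x (φ (θ n))) atTop (𝓝 y) := hy.comp hθ.tendsto_atTop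
    have hry : (cpR L).eval y = 0 := by
      have h4 := ((cont_cpR q).tendsto (L, y)).comp (hM3.prodMk_nhds hy3)
      refine tendsto_nhds_unique h4 ?_
      simp [Function.comp_def, hx2]
    have hrz : (cpR L).eval z = 0 := by
      have h4 := ((cont_cpR q).tendsto (L, z)).comp (hM3.prodMk_nhds hz)
      refine tendsto_nhds_unique h4 ?_
      simp [Function.comp_def, hx4]
    by_cases hy00 : y = 0
    · subst hy00
      obtain ⟨h3, h4⟩ := cpR_R2 hsL hry
      exact hL.1 0 h3 h4
    · have hdiv : Tendsto (fun n => ((m (φ (θ n)) : ℤ) : ℂ)) atTop (𝓝 (z / y)) := by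
        have := hz.div hy3 hy00
        refine this.congr fun n => ?_
        have := hx0 (φ (θ n))
        simp [this]
      have hcl : IsClosed (Set.range ((↑) : ℤ → ℂ) ∩ {w | 2 ≤ ‖w‖}) := 
        Complex.isClosed_range_intCast.inter (isClosed_le continuous_const continuous_norm)
      have hmem := hcl.mem_of_tendsto hdiv (Eventually.of_forall fun n => ⟨⟨_, rfl⟩, by
        have := hm (φ (θ n))
        show (2 : ℝ) ≤ _
        rw [Complex.norm_intCast]
        exact_mod_cast this⟩)
      obtain ⟨⟨k, hk⟩, h2⟩ := hmem
      have hk2 : 2 ≤ |k| := by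
        change (2 : ℝ) ≤ _ at h2
        rw [← hk, Complex.norm_intCast] at h2
        exact_mod_cast h2
      refine hL.2 k hk2 y hy0 ?_
      rw [hk, div_mul_cancel₀ _ hy00]
      exact hrz

theorem good_open (q : ℕ) : 
    IsOpen {Z : so q | Good (cx (Z : Matrix (Fin q) (Fin q) ℝ))} := by
  have : FirstCountableTopology (Matrix (Fin q) (Fin q) ℝ) :=
    inferInstanceAs (FirstCountableTopology (Fin q → Fin q → ℝ))
  rw [← isClosed_compl_iff]
  apply IsSeqClosed.isClosed
  intro Z L hZ hL
  have hc : Continuous fun Z : so q => cx (Z : Matrix (Fin q) (Fin q) ℝ) := 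
    Continuous.matrix_map continuous_subtype_val Complex.continuous_ofReal
  exact bad_closed (fun n => cx_skew (Z n)) (cx_skew L) ((hc.tendsto L).comp hL) hZ

end openness

theorem charpoly_smul' {q : ℕ} (M : Matrix (Fin q) (Fin q) ℂ) {c : ℂ} (hc : c ≠ 0) :
    (c • M).charpoly = Polynomial.C (c ^ q) * 
      M.charpoly.comp (Polynomial.C c⁻¹ * Polynomial.X) := by
  apply Polynomial.funext
  intro x
  rw [Polynomial.eval_mul, Polynomial.eval_C, Polynomial.eval_comp, Polynomial.eval_mul,
    Polynomial.eval_X, Polynomial.eval_C, Matrix.eval_charpoly, Matrix.eval_charpoly]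
  have : Matrix.scalar (Fin q) x - c • M = c • (Matrix.scalar (Fin q) (c⁻¹ * x) - M) := by
    ext i j
    by_cases hij : i = j
    · subst hij
      simp [Matrix.scalar_apply]
      field_simp
    · simp [Matrix.scalar_apply, hij]
  rw [this, Matrix.det_smul]
  simp

theorem good_smul {q : ℕ} (Z : so q) {c : ℝ} (hc : c ≠ 0)
    (h : Good (cx (Z : Matrix (Fin q) (Fin q) ℝ))) :
    Good (cx ((c • Z : so q) : Matrix (Fin q) (Fin q) ℝ)) := by
  have hc' : (c : ℂ) ≠ 0 := by exact_mod_cast hc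
  rw [← good_iff, card_eigs_iff] at h ⊢
  have he : cx ((c • Z : so q) : Matrix (Fin q) (Fin q) ℝ) = 
      (c : ℂ) • cx (Z : Matrix (Fin q) (Fin q) ℝ) := by
    ext i j
    simp [cx]
  simp only [mem_eigs_s3] at h ⊢
  rw [he, charpoly_smul' _ hc']
  obtain ⟨h1, h2⟩ := h
  constructor
  · intro x hx hx'
    simp [Polynomial.eval_comp, hc'] at hx
    rw [Polynomial.derivative_C_mul] at hx'
    simp [Polynomial.eval_comp, hc, Polynomial.derivative_comp] at hx'
    exact h1 _ hx hx'
  · intro lam mu hl hm hne hl0 hm0 m hm2 he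
    simp [Polynomial.eval_comp, hc'] at hl hm
    refine h2 _ _ hl hm ?_ (by simp [hc, hl0]) (by simp [hc, hm0]) m hm2 ?_
    · simpa [hc] using hne
    · rw [← he]
      field_simp

/-- coefficients of the good base point -/
def aa (q : ℕ) (i : Fin q) : ℝ :=
  (2 * (i : ℝ) + 1 - q) / q + SignType.sign (2 * (i : ℝ) + 1 - q)

theorem aa_rev {q : ℕ} (i : Fin q) : aa q i.rev = - aa q i := by
  have : (2 * ((i.rev : ℕ) : ℝ) + 1 - q) = - (2 * (i : ℝ) + 1 - q) := by
    rw [Fin.val_rev, Nat.cast_sub (by omega)]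
    push_cast
    ring
  unfold aa
  rw [this, Left.sign_neg]
  push_cast
  ring

theorem aa_inj {q : ℕ} : Function.Injective (aa q) := by
  apply StrictMono.injective
  intro i j hij
  have hq : (0 : ℝ) < q := by exact_mod_cast i.pos
  have h1 : (2 * (i : ℝ) + 1 - q) < (2 * (j : ℝ) + 1 - q) := by
    have : ((i : ℕ) : ℝ) < ((j : ℕ) : ℝ) := by exact_mod_cast hij
    linarith
  have h2 : ((SignType.sign (2 * (i : ℝ) + 1 - q) : SignType) : ℝ) ≤ 
      (SignType.sign (2 * (j : ℝ) + 1 - q) : SignType) := by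
    have h := SignType.sign.monotone h1.le
    generalize SignType.sign (2 * (i : ℝ) + 1 - q) = a at *
    generalize SignType.sign (2 * (j : ℝ) + 1 - q) = b at *
    revert h
    cases a <;> cases b <;> simp
  unfold aa
  have := div_lt_div_of_pos_right h1 hq
  linarith

theorem aa_bd {q : ℕ} (i : Fin q) : |aa q i| < 2 ∧ (aa q i ≠ 0 → 1 ≤ |aa q i|) := by
  have hq : (0 : ℝ) < q := by exact_mod_cast i.pos
  have hi : ((i : ℕ) : ℝ) + 1 ≤ q := by exact_mod_cast i.2
  have hi0 : (0 : ℝ) ≤ ((i : ℕ) : ℝ) := by positivity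
  have h1 : (2 * (i : ℝ) + 1 - q) / q < 1 := by
    rw [div_lt_one hq]; linarith
  have h2 : -1 < (2 * (i : ℝ) + 1 - q) / q := by
    rw [lt_div_iff₀ hq]; linarith
  unfold aa
  rcases lt_trichotomy (2 * (i : ℝ) + 1 - q) 0 with h | h | h
  · have h3 : (2 * (i : ℝ) + 1 - q) / q < 0 := div_neg_of_neg_of_pos h hq
    rw [sign_neg h]
    simp only [SignType.coe_neg_one]
    rw [abs_of_neg (by linarith)]
    exact ⟨by linarith, fun _ => by linarith⟩
  · rw [h]
    simp
  · have h3 : 0 < (2 * (i : ℝ) + 1 - q) / q := div_pos h hq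
    rw [sign_pos h]
    simp only [SignType.coe_one]
    rw [abs_of_pos (by linarith)]
    exact ⟨by linarith, fun _ => by linarith⟩

/-- the good base point -/
def Z0 (q : ℕ) : so q := ⟨Matrix.of fun i j => if j = i.rev then aa q i else 0, by
  change _ᵀ = -_
  ext i j
  simp only [Matrix.transpose_apply, Matrix.of_apply, Matrix.neg_apply]
  by_cases h : i = j.rev
  · subst h
    simp [aa_rev]
  · have h' : j ≠ i.rev := by
      rintro rfl
      simp at h
    simp [h, h']⟩

theorem Z0_root {q : ℕ} (i : Fin q) :
    (cx (Z0 q : Matrix (Fin q) (Fin q) ℝ)).charpoly.eval (Complex.I * aa q i) = 0 := by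
  rw [Matrix.eval_charpoly, ← Matrix.exists_mulVec_eq_zero_iff]
  refine ⟨fun k => (if k = i then 1 else 0) + (if k = i.rev then Complex.I else 0), ?_, ?_⟩
  · intro h
    have := congrFun h i
    simp only [Pi.zero_apply] at this
    split_ifs at this <;> simp [Complex.ext_iff] at this
  · funext k
    rw [Matrix.sub_mulVec]
    have : (cx (Z0 q : Matrix (Fin q) (Fin q) ℝ) *ᵥ fun k => (if k = i then (1 : ℂ) else 0) + (if k = i.rev then Complex.I else 0)) k = aa q k * ((if k.rev = i then (1 : ℂ) else 0) + (if k.rev = i.rev then Complex.I else 0)) := by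
      simp only [Matrix.mulVec, dotProduct]
      rw [Finset.sum_eq_single k.rev]
      · simp [cx, Z0]
      · intro b _ hb
        simp [cx, Z0, hb]
      · simp
    rw [Pi.sub_apply, this]
    simp only [Matrix.scalar_apply, Matrix.mulVec_diagonal, Fin.rev_inj, Fin.rev_eq_iff, Pi.zero_apply]
    by_cases h1 : k = i
    · subst h1
      by_cases h2 : k = k.rev
      · have := aa_rev k
        rw [← h2] at this
        have h0 : aa q k = 0 := by linarith
        simp [h0]
      · simp [h2]
        ring
    · by_cases h2 : k = i.rev
      · subst h2
        simp [h1, aa_rev]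
        linear_combination (aa q i : ℂ) * Complex.I_mul_I
      · simp [h1, h2]

theorem Z0_good (q : ℕ) : Good (cx (Z0 q : Matrix (Fin q) (Fin q) ℝ)) := by
  rw [← good_iff]
  set S : Finset ℂ := Finset.univ.image fun i : Fin q => Complex.I * aa q i with hS
  have hSc : S.card = q := by
    rw [hS, Finset.card_image_of_injective, Finset.card_univ, Fintype.card_fin]
    intro i j hij
    apply aa_inj
    have := mul_left_cancel₀ Complex.I_ne_zero hij
    exact_mod_cast this
  have hsub : S ⊆ (eigs (Z0 q : Matrix (Fin q) (Fin q) ℝ)).toFinset := by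
    intro x hx
    obtain ⟨i, _, rfl⟩ := Finset.mem_image.1 hx
    rw [Multiset.mem_toFinset, mem_eigs_s3]
    exact Z0_root i
  have hle : (eigs (Z0 q : Matrix (Fin q) (Fin q) ℝ)).toFinset.card ≤ q := by
    refine (Multiset.toFinset_card_le _).trans ?_
    rw [eigs_eq]
    refine (Polynomial.card_roots' _).trans ?_
    rw [Matrix.charpoly_natDegree_eq_dim]
    simp
  have heq := Finset.eq_of_subset_of_card_le hsub (by rw [hSc]; exact hle)
  refine ⟨by rw [← heq, hSc], ?_⟩
  intro lam mu hl hm _ hl0 hm0 m hm2 he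
  rw [← Multiset.mem_toFinset, ← heq] at hl hm
  obtain ⟨i, _, rfl⟩ := Finset.mem_image.1 hl
  obtain ⟨j, _, rfl⟩ := Finset.mem_image.1 hm
  have hj0 : aa q j ≠ 0 := by
    intro h
    simp [h] at hm0
  have h1 : aa q i = m * aa q j := by
    rw [div_eq_iff hm0] at he
    have : (aa q i : ℂ) = m * aa q j := by
      apply mul_left_cancel₀ Complex.I_ne_zero
      rw [he]; ring
    exact_mod_cast this
  have h2 := (aa_bd i).1
  have h3 := (aa_bd j).2 hj0
  rw [h1, abs_mul] at h2
  have h4 : (2 : ℝ) ≤ |(m : ℝ)| := by exact_mod_cast hm2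
  nlinarith

theorem det_aeval_iff {q : ℕ} (hq : 2 ≤ q) (M : Matrix (Fin q) (Fin q) ℂ) (r : Polynomial ℂ) :
    (Polynomial.aeval M r).det = 0 ↔ ∃ x, M.charpoly.eval x = 0 ∧ r.eval x = 0 := by
  have : NeZero q := ⟨by omega⟩
  have hne : (spectrum ℂ M).Nonempty := spectrum.nonempty_of_isAlgClosed_of_finiteDimensional ℂ M
  have h := spectrum.map_polynomial_aeval_of_nonempty M r hne
  have h0 : (Polynomial.aeval M r).det = 0 ↔ (0 : ℂ) ∈ spectrum ℂ (Polynomial.aeval M r) := by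
    rw [spectrum.zero_mem_iff, Matrix.isUnit_iff_isUnit_det, isUnit_iff_ne_zero, not_not]
  rw [h0, h]
  constructor
  · rintro ⟨x, hx, hr⟩
    exact ⟨x, Matrix.mem_spectrum_iff_isRoot_charpoly.1 hx, hr⟩
  · rintro ⟨x, hx, hr⟩
    exact ⟨x, Matrix.mem_spectrum_iff_isRoot_charpoly.2 hx, hr⟩

theorem cpR_map {R S : Type*} [CommRing R] [CommRing S] (f : R →+* S) {q : ℕ}
    (M : Matrix (Fin q) (Fin q) R) : cpR (M.map f) = (cpR M).map f := by
  unfold cpR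
  rw [Matrix.charpoly_map]
  split_ifs
  · ext k
    simp [Polynomial.coeff_divX]
  · rfl

/-- The obstruction polynomial; `none` is for repeated eigenvalues. -/
def obs {R : Type*} [CommRing R] {q : ℕ} (o : Option ℤ) (M : Matrix (Fin q) (Fin q) R) : R :=
  (Polynomial.aeval M (match o with
    | none => M.charpoly.derivative
    | some m => (cpR M).comp (Polynomial.C (m : R) * Polynomial.X))).det

theorem det_aeval_map {R S : Type*} [CommRing R] [CommRing S] (f : R →+* S) {q : ℕ}
    (M : Matrix (Fin q) (Fin q) R) (P : Polynomial R) :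
    (Polynomial.aeval (M.map f) (P.map f)).det = f (Polynomial.aeval M P).det := by
  rw [RingHom.map_det]
  congr 1
  have := Polynomial.map_aeval_eq_aeval_map (φ := f) (ψ := (f.mapMatrix :
      Matrix (Fin q) (Fin q) R →+* Matrix (Fin q) (Fin q) S)) (by
    refine RingHom.ext fun r => ?_
    ext i j
    simp only [RingHom.comp_apply, RingHom.mapMatrix_apply, Matrix.map_apply,
      Matrix.algebraMap_matrix_apply]
    split_ifs <;> simp) P M
  exact this.symm

theorem obs_map {R S : Type*} [CommRing R] [CommRing S] (f : R →+* S) {q : ℕ} (o : Option ℤ)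
    (M : Matrix (Fin q) (Fin q) R) : obs o (M.map f) = f (obs o M) := by
  unfold obs
  rw [← det_aeval_map]
  cases o with
  | none => simp only [Matrix.charpoly_map, Polynomial.derivative_map]
  | some m => simp [cpR_map, Polynomial.map_comp]

theorem good_iff_obs {q : ℕ} (hq : 2 ≤ q) (M : Matrix (Fin q) (Fin q) ℂ) :
    Good M ↔ ∀ o : Option ℤ, (∀ m, o = some m → 2 ≤ |m|) → obs o M ≠ 0 := by
  constructor
  · rintro ⟨h1, h2⟩ o ho
    unfold obs
    rw [Ne, det_aeval_iff hq]
    rintro ⟨x, hx, hr⟩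
    cases o with
    | none => exact h1 x hx hr
    | some m =>
      refine h2 m (ho m rfl) x hx ?_
      simpa [Polynomial.eval_comp] using hr
  · intro h
    constructor
    · intro x hx hr
      have := h none (by simp)
      unfold obs at this
      rw [Ne, det_aeval_iff hq] at this
      exact this ⟨x, hx, hr⟩
    · intro m hm x hx hr
      have := h (some m) (by rintro _ ⟨⟩; exact hm)
      unfold obs at this
      rw [Ne, det_aeval_iff hq] at this
      exact this ⟨x, hx, by simpa [Polynomial.eval_comp] using hr⟩

theorem exists_line_poly {q : ℕ} (o : Option ℤ) (A B : Matrix (Fin q) (Fin q) ℝ) :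
    ∃ Q : Polynomial ℝ, ∀ t : ℝ, obs o (cx (A + t • B)) = ((Q.eval t : ℝ) : ℂ) := by
  refine ⟨obs o (A.map Polynomial.C + (Polynomial.X : Polynomial ℝ) • B.map Polynomial.C), 
    fun t => ?_⟩
  have h1 : A + t • B = (A.map Polynomial.C + (Polynomial.X : Polynomial ℝ) • B.map Polynomial.C).map
      (Polynomial.evalRingHom t) := by
    ext i j
    simp
    ring
  unfold cx
  rw [obs_map, h1, obs_map]
  rfl

theorem line_ae {q : ℕ} (hq : 2 ≤ q) (Z : so q) :
    {t : ℝ | ¬ Good (cx ((Z + t • Z0 q : so q) : Matrix (Fin q) (Fin q) ℝ))}.Countable := by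
  obtain ⟨t0, ht0⟩ : ∃ t : ℝ, Good (cx ((Z + t • Z0 q : so q) : Matrix (Fin q) (Fin q) ℝ)) := by
    have hop := good_open q
    have hc : Continuous fun s : ℝ => s • Z + Z0 q := by fun_prop
    have hU := hop.preimage hc
    have h0 : (0 : ℝ) ∈ (fun s : ℝ => s • Z + Z0 q) ⁻¹' 
        {Z : so q | Good (cx (Z : Matrix (Fin q) (Fin q) ℝ))} := by
      change Good _
      simpa using Z0_good q
    obtain ⟨ε, hε, hb⟩ := Metric.isOpen_iff.1 hU 0 h0
    have h1 : Good (cx (((ε / 2) • Z + Z0 q : so q) : Matrix (Fin q) (Fin q) ℝ)) := 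
      hb (by simp [abs_of_pos hε]; linarith)
    refine ⟨(ε / 2)⁻¹, ?_⟩
    have h2 := good_smul _ (c := (ε / 2)⁻¹) (by positivity) h1
    rwa [smul_add, smul_smul, inv_mul_cancel₀ (by positivity), one_smul] at h2
  choose Q hQ using fun o => exists_line_poly o (Z : Matrix (Fin q) (Fin q) ℝ) (Z0 q : Matrix (Fin q) (Fin q) ℝ)
  refine Set.Countable.mono (s₂ := ⋃ o : {o : Option ℤ // ∀ m, o = some m → 2 ≤ |m|}, 
    {t : ℝ | (Q o.1).IsRoot t}) ?_ ?_
  · intro t ht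
    change ¬ Good _ at ht
    rw [good_iff_obs hq] at ht
    push Not at ht
    obtain ⟨o, ho, h⟩ := ht
    refine Set.mem_iUnion.2 ⟨⟨o, ho⟩, ?_⟩
    have h' := hQ o t
    change Polynomial.eval t (Q o) = 0
    have h3 : ((Polynomial.eval t (Q o) : ℝ) : ℂ) = 0 := by
      rw [← h']; exact h
    exact_mod_cast h3
  · refine Set.countable_iUnion fun o => Set.Finite.countable ?_
    apply Polynomial.finite_setOfPred_isRoot
    intro hz
    have := (good_iff_obs hq _).1 ht0 o.1 o.2
    apply this
    have h' := hQ o.1 t0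
    rw [hz] at h'
    simpa using h'

theorem null_of_lines {F : Type*} [NormedAddCommGroup F] [NormedSpace ℝ F]
    [FiniteDimensional ℝ F] [MeasurableSpace F] [BorelSpace F] (μ : Measure F)
    (hμ : μ.IsAddHaarMeasure) (s : Set F) (hs : IsOpen s) (v : F)
    (h : ∀ y : F, {t : ℝ | ¬ (y + t • v ∈ s)}.Countable) : μ sᶜ = 0 := by
  have : ProperSpace F := FiniteDimensional.proper_real F
  exact ae_mem_of_ae_add_linearMap_mem (LinearMap.toSpanSingleton ℝ F v) volume μ
    hs.measurableSet fun y => (h y).measure_zero volume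

theorem good_null {q : ℕ} (hq : 2 ≤ q) (μ : Measure (so q)) (hμ : μ.IsAddHaarMeasure) :
    μ {Z : so q | Good (cx (Z : Matrix (Fin q) (Fin q) ℝ))}ᶜ = 0 := by
  have hB : BorelSpace (Matrix (Fin q) (Fin q) ℝ) :=
    inferInstanceAs (BorelSpace (Fin q → Fin q → ℝ))
  have hB2 : BorelSpace (so q) := Subtype.borelSpace _
  have hF : FiniteDimensional ℝ (so q) := inferInstance
  let n1 : NormedAddCommGroup (Matrix (Fin q) (Fin q) ℝ) := Matrix.normedAddCommGroup
  let n2 : NormedSpace ℝ (Matrix (Fin q) (Fin q) ℝ) := Matrix.normedSpace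
  let n3 : NormedAddCommGroup (so q) := Submodule.normedAddCommGroup _
  let n4 : NormedSpace ℝ (so q) := Submodule.normedSpace _
  exact @null_of_lines (so q) n3 n4 hF _ hB2 μ hμ _ (good_open q) (Z0 q) (line_ae hq)

theorem conj_good {q : ℕ} {g : Matrix (Fin q) (Fin q) ℝ} (hg : g * gᵀ = 1) (Z : so q) :
    ∃ W : so q, (W : Matrix (Fin q) (Fin q) ℝ) = g * Z * gᵀ ∧ 
      eigs (W : Matrix (Fin q) (Fin q) ℝ) = eigs (Z : Matrix (Fin q) (Fin q) ℝ) := by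
  have hZ : (Z : Matrix (Fin q) (Fin q) ℝ)ᵀ = -Z := Z.2
  refine ⟨⟨g * Z * gᵀ, ?_⟩, rfl, ?_⟩
  · change _ᵀ = -_
    rw [Matrix.transpose_mul, Matrix.transpose_mul, hZ, Matrix.transpose_transpose]
    simp [Matrix.mul_assoc]
  · unfold eigs
    have := Matrix.charpoly_units_conj ⟨g, gᵀ, hg, mul_eq_one_comm.1 hg⟩ (Z : Matrix (Fin q) (Fin q) ℝ)
    have h2 : (g * (Z : Matrix (Fin q) (Fin q) ℝ) * gᵀ).charpoly = 
      (Z : Matrix (Fin q) (Fin q) ℝ).charpoly := by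
      rw [← this]
      congr 2
      exact (Matrix.inv_eq_right_inv hg).symm
    change ((g * (Z : Matrix (Fin q) (Fin q) ℝ) * gᵀ).charpoly.map _).roots = _
    rw [h2]

/-- for `q ≥ 2`, the set `O` of `Z ∈ so(q,ℝ)` with distinct eigenvalues such
that no ratio of two distinct nonzero eigenvalues is an integer of absolute value `≥ 2`
is (a) open in the norm topology of `so(q,ℝ)`, (b) invariant under conjugation by elements
of `O(q,ℝ)`, and (c) has complement of measure zero for every Haar (Lebesgue) measure on
the finite-dimensional real vector space `so(q,ℝ)`. -/
theorem stmt3 (q : ℕ) (hq : 2 ≤ q)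
    (O : Set (so q))
    (hO : O = {Z : so q | (eigs (Z : Matrix (Fin q) (Fin q) ℝ)).toFinset.card = q ∧
      ∀ lam mu : ℂ, lam ∈ eigs (Z : Matrix (Fin q) (Fin q) ℝ) →
        mu ∈ eigs (Z : Matrix (Fin q) (Fin q) ℝ) →
        lam ≠ mu → lam ≠ 0 → mu ≠ 0 →
        ∀ m : ℤ, 2 ≤ |m| → lam / mu ≠ (m : ℂ)}) :
    IsOpen O ∧
    (∀ g : Matrix (Fin q) (Fin q) ℝ, g * gᵀ = 1 →
      (fun Z : so q => g * (Z : Matrix (Fin q) (Fin q) ℝ) * g⁻¹) '' O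
        = ((↑) : so q → Matrix (Fin q) (Fin q) ℝ) '' O) ∧
    (∀ μ : Measure (so q), μ.IsAddHaarMeasure → μ Oᶜ = 0) := by
  have hOG : O = {Z : so q | Good (cx (Z : Matrix (Fin q) (Fin q) ℝ))} := by
    rw [hO]
    ext Z
    exact good_iff Z
  refine ⟨?_, ?_, ?_⟩
  · rw [hOG]
    exact good_open q
  · intro g hg
    have hinv : g⁻¹ = gᵀ := Matrix.inv_eq_right_inv hg
    have hg' : gᵀ * gᵀᵀ = 1 := by
      rw [Matrix.transpose_transpose]
      exact mul_eq_one_comm.1 hg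
    have hmem : ∀ Z W : so q, eigs (W : Matrix (Fin q) (Fin q) ℝ) =
        eigs (Z : Matrix (Fin q) (Fin q) ℝ) → Z ∈ O → W ∈ O := by
      intro Z W he hZ
      rw [hO] at hZ ⊢
      change _ ∧ _ at hZ
      change _ ∧ _
      rw [he]
      exact hZ
    apply Set.Subset.antisymm
    · rintro _ ⟨Z, hZ, rfl⟩
      obtain ⟨W, hW, he⟩ := conj_good hg Z
      refine ⟨W, hmem Z W he hZ, ?_⟩
      rw [hW]
      simp only [hinv]
    · rintro _ ⟨Z, hZ, rfl⟩
      obtain ⟨W, hW, he⟩ := conj_good hg' Z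
      refine ⟨W, hmem Z W he hZ, ?_⟩
      simp only [hinv]
      rw [hW, Matrix.transpose_transpose]
      calc g * (gᵀ * (Z : Matrix (Fin q) (Fin q) ℝ) * g) * gᵀ
          = (g * gᵀ) * Z * (g * gᵀ) := by simp only [Matrix.mul_assoc]
        _ = Z := by rw [hg, Matrix.one_mul, Matrix.mul_one]
  · intro μ hμ
    rw [hOG]
    exact good_null hq μ hμ
end
end
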